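/- Let n, p ≥ 1, B⁺ = {b ∈ ℝ^p : b₁ ≥ … ≥ b_p ≥ 1}, and λ ∈ ℝ^p with λ ≺ 0. Let φ : B⁺ → ℝ be measurable and suppose there is C₀ > 0 with |φ(b)| · ∏_{i=1}^{p} b_i^{-(n-1)} ≤ C₀ ∏_{i=1}^{p} b_i^{λ_i} for all b ∈ B⁺. Then for every a ∈ [1,∞)^n the integral L(a,φ) = ∫_{B⁺} ( ∏_{i=1}^{p} ∏_{k=1}^{n} (a_k² + b_i²)^{-1/2} ) φ(b) db converges absolutely. Moreover, for any family η_{k,i} ∈ [0,1] (1 ≤ k ≤ n, 1 ≤ i ≤ p) satisfying ∑_{i=1}^{j} (λ_i + ∑_{k=1}^{n} η_{k,i}) < 0 for every j ∈ {1,…,p}, there is a constant C > 0 (independent of a) such that |L(a,φ)| ≤ C ∏_{k=1}^{n} a_k^{-μ_k} for all a ∈ [1,∞)^n, where μ_k = ∑_{i=1}^{p} η_{k,i}. -/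

import Mathlib

open MeasureTheory Set Finset

/-- The region `B⁺ = {b ∈ ℝ^p : b₁ ≥ b₂ ≥ … ≥ b_p ≥ 1}`. -/
def Bplus (p : ℕ) : Set (Fin p → ℝ) :=
  {b | (∀ i, 1 ≤ b i) ∧ ∀ i j : Fin p, i ≤ j → b j ≤ b i}

/-- Abel summation: a weighted sum of a nonnegative antitone sequence is nonpositive when all the
partial sums of the weights are. -/
theorem sum_mul_nonpos_of_antitone {p : ℕ} (t x : Fin p → ℝ) (hx : Antitone x)
    (hx0 : ∀ i, 0 ≤ x i) (ht : ∀ j, ∑ i ∈ Finset.Iic j, t i ≤ 0) :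
    ∑ i, t i * x i ≤ 0 := by
  induction p with
  | zero => simp
  | succ p ih =>
    have h := ih (fun i => t i.castSucc) (fun i => x i.castSucc - x (Fin.last p))
      (fun i j hij => sub_le_sub_right (hx (Fin.castSucc_le_castSucc_iff.2 hij)) _)
      (fun i => sub_nonneg.2 (hx (Fin.le_last _)))
      (fun j => by
        have := ht j.castSucc
        rwa [← Fin.map_castSuccEmb_Iic, Finset.sum_map] at this)
    have hlast := ht (Fin.last p)
    have huniv : Finset.Iic (Fin.last p) = Finset.univ := by
      ext i; simp [Fin.le_last]
    rw [huniv, Fin.sum_univ_castSucc] at hlast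
    have hmul := mul_nonpos_of_nonpos_of_nonneg hlast (hx0 (Fin.last p))
    simp only [mul_sub, Finset.sum_sub_distrib, ← Finset.sum_mul] at h
    rw [Fin.sum_univ_castSucc]
    linarith

theorem exists_pos_sum_Iic_add_nonpos {p : ℕ} (s : Fin p → ℝ)
    (hs : ∀ j, ∑ i ∈ Finset.Iic j, s i < 0) :
    ∃ ε > (0 : ℝ), ∀ j, ∑ i ∈ Finset.Iic j, (s i + ε) ≤ 0 := by
  rcases isEmpty_or_nonempty (Fin p) with _ | _
  · exact ⟨1, one_pos, fun j => isEmptyElim j⟩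
  obtain ⟨m, hm⟩ := Finite.exists_max fun j => ∑ i ∈ Finset.Iic j, s i
  have hp : (0 : ℝ) < p := by exact_mod_cast m.pos
  have hε : 0 < -(∑ i ∈ Finset.Iic m, s i) / p := div_pos (neg_pos.2 (hs m)) hp
  refine ⟨_, hε, fun j => ?_⟩
  have hcard : ((Finset.Iic j).card : ℝ) ≤ p := by
    exact_mod_cast (Finset.card_le_univ _).trans_eq (Fintype.card_fin p)
  have h := mul_le_mul_of_nonneg_right hcard hε.le
  rw [mul_div_cancel₀ _ hp.ne'] at h
  rw [Finset.sum_add_distrib, Finset.sum_const, nsmul_eq_mul]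
  linarith [hm j]

theorem prod_rpow_le_of_mem_Bplus {p : ℕ} {s : Fin p → ℝ} {ε : ℝ}
    (hs : ∀ j, ∑ i ∈ Finset.Iic j, (s i + ε) ≤ 0) {b : Fin p → ℝ} (hb : b ∈ Bplus p) :
    ∏ i, b i ^ (s i - 1) ≤ ∏ i, b i ^ (-1 - ε) := by
  have hpos i : 0 < b i := one_pos.trans_le (hb.1 i)
  have h := sum_mul_nonpos_of_antitone (fun i => s i + ε) (fun i => Real.log (b i))
    (fun i j hij => Real.log_le_log (hpos j) (hb.2 i j hij))
    (fun i => Real.log_nonneg (hb.1 i)) hs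
  simp only [Real.rpow_def_of_pos (hpos _), ← Real.exp_sum]
  rw [Real.exp_le_exp, ← sub_nonpos, ← Finset.sum_sub_distrib]
  convert h using 2
  ring

theorem measurableSet_Bplus (p : ℕ) : MeasurableSet (Bplus p) := by
  unfold Bplus
  measurability

theorem integrableOn_Bplus_prod_rpow (p : ℕ) {r : ℝ} (hr : r < -1) :
    IntegrableOn (fun b : Fin p → ℝ => ∏ i, b i ^ r) (Bplus p) := by
  have h : IntegrableOn (fun b : Fin p → ℝ => ∏ i, b i ^ r)
      (Set.univ.pi fun _ => Set.Ici (1 : ℝ)) := by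
    rw [IntegrableOn, volume_pi, Measure.restrict_pi_pi]
    have h₁ : IntegrableOn (fun x : ℝ => x ^ r) (Set.Ici 1) := by
      rw [integrableOn_Ici_iff_integrableOn_Ioi]
      exact integrableOn_Ioi_rpow_of_lt hr one_pos
    exact Integrable.fintype_prod fun _ => h₁
  exact h.mono_set fun b hb i _ => hb.1 i

theorem add_sq_rpow_neg_half_le {a b η : ℝ} (ha : 0 < a) (hb : 0 < b)
    (hη : η ∈ Set.Icc (0 : ℝ) 1) :
    (a ^ 2 + b ^ 2) ^ (-(1 : ℝ) / 2) ≤ a ^ (-η) * b ^ (η - 1) := by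
  have hr : 0 < √(a ^ 2 + b ^ 2) := by positivity
  have hrw : (a ^ 2 + b ^ 2) ^ (-(1 : ℝ) / 2) =
      √(a ^ 2 + b ^ 2) ^ (-η) * √(a ^ 2 + b ^ 2) ^ (η - 1) := by
    rw [← Real.rpow_add hr, Real.sqrt_eq_rpow, ← Real.rpow_mul (by positivity)]
    congr 1
    ring
  rw [hrw]
  have hra : a ≤ √(a ^ 2 + b ^ 2) := Real.le_sqrt_of_sq_le (by nlinarith)
  have hrb : b ≤ √(a ^ 2 + b ^ 2) := Real.le_sqrt_of_sq_le (by nlinarith)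
  exact mul_le_mul (Real.rpow_le_rpow_of_nonpos ha hra (by linarith [hη.1]))
    (Real.rpow_le_rpow_of_nonpos hb hrb (by linarith [hη.2])) (by positivity) (by positivity)

theorem prod_kernel_le {n p : ℕ} {η : Fin n → Fin p → ℝ}
    (hη : ∀ k i, η k i ∈ Set.Icc (0 : ℝ) 1) {a : Fin n → ℝ} (ha : ∀ k, 0 < a k)
    {b : Fin p → ℝ} (hb : ∀ i, 0 < b i) :
    ∏ i, ∏ k, (a k ^ 2 + b i ^ 2) ^ (-(1 : ℝ) / 2) ≤
      (∏ k, a k ^ (-(∑ i, η k i))) * ∏ i, b i ^ (∑ k, η k i - n) := by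
  calc
    _ ≤ ∏ i, ∏ k, (a k ^ (-η k i) * b i ^ (η k i - 1)) :=
      Finset.prod_le_prod (fun i _ => Finset.prod_nonneg fun k _ => by positivity) fun i _ =>
        Finset.prod_le_prod (fun k _ => by positivity) fun k _ =>
          add_sq_rpow_neg_half_le (ha k) (hb i) (hη k i)
    _ = _ := by
      simp only [Finset.prod_mul_distrib]
      congr 1
      · rw [Finset.prod_comm]
        refine Finset.prod_congr rfl fun k _ => ?_
        rw [← Finset.sum_neg_distrib, Real.rpow_sum_of_pos (ha k)]
      · refine Finset.prod_congr rfl fun i _ => ?_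
        rw [← Real.rpow_sum_of_pos (hb i)]
        simp

theorem exists_pos_abs_kernel_mul_le {n p : ℕ} {lam : Fin p → ℝ} {φ : (Fin p → ℝ) → ℝ} {C₀ : ℝ}
    (hC₀ : 0 < C₀)
    (hbound : ∀ b ∈ Bplus p,
      |φ b| * ∏ i, b i ^ (-((n : ℝ) - 1)) ≤ C₀ * ∏ i, b i ^ lam i)
    {η : Fin n → Fin p → ℝ} (hη : ∀ k i, η k i ∈ Set.Icc (0 : ℝ) 1)
    (hsum : ∀ j : Fin p, ∑ i ∈ Finset.Iic j, (lam i + ∑ k, η k i) < 0) :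
    ∃ ε > (0 : ℝ), ∀ a : Fin n → ℝ, (∀ k, 1 ≤ a k) → ∀ b ∈ Bplus p,
      |(∏ i, ∏ k, (a k ^ 2 + b i ^ 2) ^ (-(1 : ℝ) / 2)) * φ b| ≤
        C₀ * (∏ k, a k ^ (-(∑ i, η k i))) * ∏ i, b i ^ (-1 - ε) := by
  obtain ⟨ε, hε, hle⟩ := exists_pos_sum_Iic_add_nonpos _ hsum
  refine ⟨ε, hε, fun a ha b hb => ?_⟩
  have hbpos i : 0 < b i := one_pos.trans_le (hb.1 i)
  have hapos k : 0 < a k := one_pos.trans_le (ha k)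
  have hA : 0 ≤ ∏ k, a k ^ (-(∑ i, η k i)) :=
    Finset.prod_nonneg fun k _ => Real.rpow_nonneg (hapos k).le _
  have hker : 0 ≤ ∏ i, ∏ k, (a k ^ 2 + b i ^ 2) ^ (-(1 : ℝ) / 2) :=
    Finset.prod_nonneg fun i _ => Finset.prod_nonneg fun k _ => by positivity
  have hsplit : ∏ i, b i ^ (∑ k, η k i - n) =
      (∏ i, b i ^ (-((n : ℝ) - 1))) * ∏ i, b i ^ (∑ k, η k i - 1) := by
    rw [← Finset.prod_mul_distrib]
    refine Finset.prod_congr rfl fun i _ => ?_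
    rw [← Real.rpow_add (hbpos i)]
    congr 1
    ring
  have hjoin : (∏ i, b i ^ lam i) * ∏ i, b i ^ (∑ k, η k i - 1) =
      ∏ i, b i ^ ((lam i + ∑ k, η k i) - 1) := by
    rw [← Finset.prod_mul_distrib]
    refine Finset.prod_congr rfl fun i _ => ?_
    rw [← Real.rpow_add (hbpos i), add_sub_assoc]
  have hB : 0 ≤ ∏ i, b i ^ (∑ k, η k i - 1) :=
    Finset.prod_nonneg fun i _ => Real.rpow_nonneg (hbpos i).le _
  rw [abs_mul, abs_of_nonneg hker]
  calc
    _ ≤ ((∏ k, a k ^ (-(∑ i, η k i))) * ∏ i, b i ^ (∑ k, η k i - n)) * |φ b| :=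
      mul_le_mul_of_nonneg_right (prod_kernel_le hη hapos hbpos) (abs_nonneg _)
    _ = (∏ k, a k ^ (-(∑ i, η k i))) *
        ((|φ b| * ∏ i, b i ^ (-((n : ℝ) - 1))) * ∏ i, b i ^ (∑ k, η k i - 1)) := by
      rw [hsplit]; ring
    _ ≤ (∏ k, a k ^ (-(∑ i, η k i))) *
        ((C₀ * ∏ i, b i ^ lam i) * ∏ i, b i ^ (∑ k, η k i - 1)) := by
      exact mul_le_mul_of_nonneg_left (mul_le_mul_of_nonneg_right (hbound b hb) hB) hA
    _ = C₀ * (∏ k, a k ^ (-(∑ i, η k i))) * ∏ i, b i ^ ((lam i + ∑ k, η k i) - 1) := by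
      rw [← hjoin]; ring
    _ ≤ _ := mul_le_mul_of_nonneg_left (prod_rpow_le_of_mem_Bplus hle hb) (by positivity)

/-- Let `n, p ≥ 1`, `λ ≺ 0`, and `φ : B⁺ → ℝ` measurable with
`|φ(b)| ∏ᵢ bᵢ^{-(n-1)} ≤ C₀ ∏ᵢ bᵢ^{λᵢ}` on `B⁺`. Then for every `a ∈ [1,∞)^n` the
integral `L(a,φ) = ∫_{B⁺} (∏ᵢ∏ₖ (aₖ²+bᵢ²)^{-1/2}) φ(b) db` converges absolutely.
Moreover, for any family `η_{k,i} ∈ [0,1]` with `∑_{i≤j} (λᵢ + ∑ₖ η_{k,i}) < 0`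
for all `j`, there is `C > 0` independent of `a` with
`|L(a,φ)| ≤ C ∏ₖ aₖ^{-μₖ}`, where `μₖ = ∑ᵢ η_{k,i}`. -/
theorem stmt_10 (n p : ℕ) (hn : 1 ≤ n) (hp : 1 ≤ p) (lam : Fin p → ℝ)
    (hlam : ∀ j : Fin p, ∑ i ∈ Finset.Iic j, lam i < 0)
    (φ : (Fin p → ℝ) → ℝ) (hφmeas : Measurable φ)
    (C₀ : ℝ) (hC₀ : 0 < C₀)
    (hbound : ∀ b ∈ Bplus p,
      |φ b| * ∏ i, b i ^ (-((n : ℝ) - 1)) ≤ C₀ * ∏ i, b i ^ lam i) :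
    (∀ a : Fin n → ℝ, (∀ k, 1 ≤ a k) →
      IntegrableOn
        (fun b : Fin p → ℝ =>
          (∏ i, ∏ k, (a k ^ 2 + b i ^ 2) ^ (-(1 : ℝ) / 2)) * φ b)
        (Bplus p)) ∧
    (∀ η : Fin n → Fin p → ℝ, (∀ k i, η k i ∈ Set.Icc (0 : ℝ) 1) →
      (∀ j : Fin p, ∑ i ∈ Finset.Iic j, (lam i + ∑ k, η k i) < 0) →
      ∃ C > (0 : ℝ), ∀ a : Fin n → ℝ, (∀ k, 1 ≤ a k) →
        |∫ b in Bplus p,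
            (∏ i, ∏ k, (a k ^ 2 + b i ^ 2) ^ (-(1 : ℝ) / 2)) * φ b| ≤
          C * ∏ k, a k ^ (-(∑ i, η k i))) := by
  refine ⟨fun a ha => ?_, fun η hη hsum => ?_⟩
  · obtain ⟨ε, hε, hle⟩ := exists_pos_abs_kernel_mul_le (η := fun _ _ => 0) hC₀ hbound
      (fun _ _ => ⟨le_rfl, zero_le_one⟩) (by simpa using hlam)
    refine Integrable.mono' ((integrableOn_Bplus_prod_rpow p (by linarith)).const_mul _) ?_
      (ae_restrict_of_forall_mem (measurableSet_Bplus p) (hle a ha))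
    exact Measurable.aestronglyMeasurable (by fun_prop)
  · obtain ⟨ε, hε, hle⟩ := exists_pos_abs_kernel_mul_le hC₀ hbound hη hsum
    have hK : 0 ≤ ∫ b in Bplus p, ∏ i, b i ^ (-1 - ε) :=
      setIntegral_nonneg (measurableSet_Bplus p) fun b hb => Finset.prod_nonneg fun i _ =>
        Real.rpow_nonneg (zero_le_one.trans (hb.1 i)) _
    refine ⟨C₀ * (∫ b in Bplus p, ∏ i, b i ^ (-1 - ε)) + 1, by positivity, fun a ha => ?_⟩
    have hA : 0 ≤ ∏ k, a k ^ (-(∑ i, η k i)) :=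
      Finset.prod_nonneg fun k _ => Real.rpow_nonneg (zero_le_one.trans (ha k)) _
    have h := norm_integral_le_of_norm_le (f := fun b : Fin p → ℝ =>
      (∏ i, ∏ k, (a k ^ 2 + b i ^ 2) ^ (-(1 : ℝ) / 2)) * φ b)
      ((integrableOn_Bplus_prod_rpow p (r := -1 - ε) (by linarith)).const_mul
        (C₀ * ∏ k, a k ^ (-(∑ i, η k i))))
      (ae_restrict_of_forall_mem (measurableSet_Bplus p) (hle a ha))
    rw [integral_const_mul] at h
    refine h.trans ?_
    linarith
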